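/- Assume the Generalized Continuum Hypothesis (for every infinite cardinal κ, 2^κ = κ⁺). Then for any ultrafilters U on X and W on Y, the tensor products commute (U ⋉ W = U ⋊ W) if and only if the Cartesian product U × W is an ultrafilter on X×Y. -/

import Mathlib

open Filter Set Cardinal

universe u v w

/-- The left tensor product `F ⋉ G` of two filters. -/
def ltimes {X : Type u} {Y : Type v} (F : Filter X) (G : Filter Y) :
    Filter (X × Y) where
  sets := {R | {x | {y | (x, y) ∈ R} ∈ G} ∈ F}
  univ_sets := by simp
  sets_of_superset := by
    intro R S hR hRS
    refine Filter.mem_of_superset hR ?_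
    intro x hx
    exact Filter.mem_of_superset hx fun y hy => hRS hy
  inter_sets := by
    intro R S hR hS
    refine Filter.mem_of_superset (Filter.inter_mem hR hS) ?_
    rintro x ⟨hx1, hx2⟩
    exact Filter.inter_mem hx1 hx2

/-- The right tensor product `F ⋊ G` of two filters. -/
def rtimes {X : Type u} {Y : Type v} (F : Filter X) (G : Filter Y) :
    Filter (X × Y) where
  sets := {R | {y | {x | (x, y) ∈ R} ∈ F} ∈ G}
  univ_sets := by simp
  sets_of_superset := by
    intro R S hR hRS
    refine Filter.mem_of_superset hR ?_
    intro y hy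
    exact Filter.mem_of_superset hy fun x hx => hRS hx
  inter_sets := by
    intro R S hR hS
    refine Filter.mem_of_superset (Filter.inter_mem hR hS) ?_
    rintro y ⟨hy1, hy2⟩
    exact Filter.inter_mem hy1 hy2

/-- `IsFClosed F G` means: `G` is `F`-closed. -/
def IsFClosed {X : Type u} {Y : Type v} (F : Filter X) (G : Filter Y) : Prop :=
  ∀ B : X → Set Y, (∀ x, B x ∈ G) → ∃ A ∈ F, (⋂ x ∈ A, B x) ∈ G

/-- `IsRegularFor F G` means: `F` is `G`-regular. -/
def IsRegularFor {X : Type u} {Y : Type v} (F : Filter X) (G : Filter Y) : Prop :=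
  ∃ A : Y → Set X, (∀ y, A y ∈ F) ∧ ∀ B : Set Y, Bᶜ ∉ G → (⋂ y ∈ B, A y) = ∅

/-- The Katetov order on filters: `G ≤kat H` iff some pushforward of `H` extends `G`. -/
def Katetov {Y : Type u} {Z : Type v} (G : Filter Y) (H : Filter Z) : Prop :=
  ∃ f : Z → Y, Filter.map f H ≤ G

/-- A filter is an ultrafilter. -/
def IsUltra {α : Type u} (F : Filter α) : Prop :=
  ∃ V : Ultrafilter α, (V : Filter α) = F

/-- `(λ, η)`-indecomposability of a filter. -/
def Indecomposable {X : Type u} (F : Filter X) (lam eta : Cardinal.{u}) : Prop :=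
  ∀ P : Set (Set X), #P ≤ eta → ⋃₀ P ∈ F →
    ∃ Q ⊆ P, #Q < lam ∧ ⋃₀ Q ∈ F

/-- `λ`-decomposability: the negation of `(λ, λ)`-indecomposability. -/
def Decomposable {X : Type u} (F : Filter X) (lam : Cardinal.{u}) : Prop :=
  ¬ Indecomposable F lam lam

/-- `(κ, δ)`-regularity of a filter. -/
def CardRegular {X : Type u} (F : Filter X) (kappa delta : Cardinal.{u}) : Prop :=
  ∃ B : delta.out → Set X, (∀ α, B α ∈ F) ∧
    ∀ σ : Set delta.out, kappa ≤ #σ → (⋂ α ∈ σ, B α) = ∅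

/-- The Fréchet filter `F_λ(λ)`: subsets of (a set of size) `λ` whose complement
has cardinality less than `λ`. -/
def frechetFilter (lam : Cardinal.{u}) (h : ℵ₀ ≤ lam) : Filter lam.out where
  sets := {A | #(Aᶜ : Set lam.out) < lam}
  univ_sets := by
    have : #((Set.univ : Set lam.out)ᶜ : Set lam.out) = 0 := by simp
    simp only [Set.mem_setOf_eq, this]
    exact lt_of_lt_of_le aleph0_pos h
  sets_of_superset := by
    intro A B hA hAB
    exact lt_of_le_of_lt (Cardinal.mk_le_mk_of_subset (Set.compl_subset_compl.mpr hAB)) hA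
  inter_sets := by
    intro A B hA hB
    simp only [Set.mem_setOf_eq, Set.compl_inter]
    exact lt_of_le_of_lt (Cardinal.mk_union_le _ _) (Cardinal.add_lt_of_lt h hA hB)

/-- The dual of a filter `F` on `X`: the family of complements of members of `F`. -/
def dualFamily {X : Type u} (F : Filter X) : Set (Set X) := {s | sᶜ ∈ F}

/-- The fine filter `𝔽(F)` on the dual of `F`, generated by the sets
`{σ ∈ F* | x ∈ σ}` for `x ∈ X`. -/
def fineFilter {X : Type u} (F : Filter X) : Filter (dualFamily F) :=
  Filter.generate (Set.range fun x : X => {σ : dualFamily F | x ∈ σ.1})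

theorem mem_ltimes {X : Type u} {Y : Type v} {F : Filter X} {G : Filter Y} {R : Set (X × Y)} :
    R ∈ ltimes F G ↔ ∀ᶠ x in F, ∀ᶠ y in G, (x, y) ∈ R := Iff.rfl

theorem mem_rtimes {X : Type u} {Y : Type v} {F : Filter X} {G : Filter Y} {R : Set (X × Y)} :
    R ∈ rtimes F G ↔ ∀ᶠ y in G, ∀ᶠ x in F, (x, y) ∈ R := Iff.rfl

theorem ltimes_le_prod {X : Type u} {Y : Type v} (F : Filter X) (G : Filter Y) :
    ltimes F G ≤ F ×ˢ G := by
  intro R hR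
  exact Filter.Eventually.curry hR

theorem rtimes_le_prod {X : Type u} {Y : Type v} (F : Filter X) (G : Filter Y) :
    rtimes F G ≤ F ×ˢ G := by
  intro R hR
  obtain ⟨A, hA, B, hB, hAB⟩ := Filter.mem_prod_iff.1 hR
  exact mem_rtimes.2 (Filter.mem_of_superset hB fun y hy =>
    Filter.mem_of_superset hA fun x hx => hAB ⟨hx, hy⟩)

theorem ltimes_neBot {X : Type u} {Y : Type v} (F : Filter X) (G : Filter Y) [F.NeBot] [G.NeBot] :
    (ltimes F G).NeBot := by
  refine ⟨fun h => ?_⟩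
  have h0 : (∅ : Set (X × Y)) ∈ ltimes F G := h ▸ Filter.mem_bot
  simp [mem_ltimes, NeBot.ne ‹F.NeBot›, NeBot.ne ‹G.NeBot›] at h0

theorem rtimes_neBot {X : Type u} {Y : Type v} (F : Filter X) (G : Filter Y) [F.NeBot] [G.NeBot] :
    (rtimes F G).NeBot := by
  refine ⟨fun h => ?_⟩
  have h0 : (∅ : Set (X × Y)) ∈ rtimes F G := h ▸ Filter.mem_bot
  simp [mem_rtimes, NeBot.ne ‹F.NeBot›, NeBot.ne ‹G.NeBot›] at h0

/-- The left tensor product of two ultrafilters is an ultrafilter. -/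
theorem isUltra_ltimes {X Y : Type u} (U : Ultrafilter X) (W : Ultrafilter Y) :
    IsUltra (ltimes (U : Filter X) (W : Filter Y)) := by
  refine ⟨Ultrafilter.ofComplNotMemIff _ fun R => ?_, rfl⟩
  change ¬ (∀ᶠ x in U, ∀ᶠ y in W, ¬ (x, y) ∈ R) ↔ ∀ᶠ x in U, ∀ᶠ y in W, (x, y) ∈ R
  simp only [Ultrafilter.eventually_not, not_not]

/-- The two tensor products agree, spelled out with iterated quantifiers. -/
def TensorCommute {X : Type u} {Y : Type v} (F : Filter X) (G : Filter Y) : Prop :=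
  ∀ R : X → Y → Prop, (∀ᶠ x in F, ∀ᶠ y in G, R x y) ↔ ∀ᶠ y in G, ∀ᶠ x in F, R x y

theorem ltimes_eq_rtimes_iff {X : Type u} {Y : Type v} {F : Filter X} {G : Filter Y} :
    ltimes F G = rtimes F G ↔ TensorCommute F G := by
  rw [Filter.ext_iff]
  exact ⟨fun h R => h {p | R p.1 p.2}, fun h R => h fun x y => (x, y) ∈ R⟩

theorem TensorCommute.symm {X : Type u} {Y : Type v} {F : Filter X} {G : Filter Y}
    (h : TensorCommute F G) : TensorCommute G F := fun R => (h fun x y => R y x).symm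

theorem TensorCommute.map_left {X : Type u} {Y : Type v} {Z : Type w} {F : Filter X} {G : Filter Y}
    (h : TensorCommute F G) (f : X → Z) : TensorCommute (map f F) G := fun R => h fun x y => R (f x) y

/-- Every relation holding `F`-eventually, `G`-eventually holds on a rectangle. -/
def RectangleDetermined {X : Type u} {Y : Type v} (F : Filter X) (G : Filter Y) : Prop :=
  ∀ R : X → Y → Prop, (∀ᶠ x in F, ∀ᶠ y in G, R x y) → ∀ᶠ p in F ×ˢ G, R p.1 p.2

theorem RectangleDetermined.symm {X : Type u} {Y : Type v} {F : Filter X} {G : Filter Y}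
    (h : RectangleDetermined F G) (hc : TensorCommute F G) : RectangleDetermined G F := by
  intro R hR
  have := h (fun x y => R y x) ((hc fun x y => R y x).2 hR)
  exact Filter.eventually_swap_iff.2 this

theorem RectangleDetermined.map_left {X : Type u} {Y : Type v} {Z : Type w} {F : Filter X}
    {G : Filter Y} (h : RectangleDetermined F G) (f : X → Z) :
    RectangleDetermined (map f F) G := by
  intro R hR
  have := h (fun x y => R (f x) y) hR
  have h2 : map (Prod.map f id) (F ×ˢ G) = map f F ×ˢ G := by
    rw [← Filter.prod_map_map_eq', Filter.map_id]
  rw [← h2, Filter.eventually_map]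
  exact this

theorem rectangleDetermined_of_finite {X : Type u} {Y : Type v} [Finite X] (F : Filter X)
    (G : Filter Y) : RectangleDetermined F G := by
  intro R hR
  have h : ∀ᶠ y in G, ∀ x ∈ {x | ∀ᶠ y in G, R x y}, R x y :=
    (Set.toFinite _).eventually_all.2 fun x hx => hx
  filter_upwards [hR.prod_mk h] with p hp using hp.2 _ hp.1

/-- An ultrafilter all of whose members have full cardinality. -/
def IsUniform {X : Type u} (U : Ultrafilter X) : Prop :=
  ∀ A : Set X, A ∈ U → #X ≤ #A

/-- Every ultrafilter is carried by a uniform ultrafilter on a subset of the underlying type. -/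
theorem exists_isUniform_map {X : Type u} (U : Ultrafilter X) :
    ∃ (A : Set X) (r : X → A), IsUniform (U.map r) ∧ (U.map r).map ((↑) : A → X) = U := by
  classical
  obtain ⟨A, hA, hmin⟩ := exists_minimalFor_of_wellFoundedLT (fun A : Set X => A ∈ U)
    (fun A => #A) ⟨univ, Filter.univ_mem⟩
  obtain ⟨a, ha⟩ := U.nonempty_of_mem hA
  let r : X → A := fun x => if hx : x ∈ A then ⟨x, hx⟩ else ⟨a, ha⟩
  have hr : ∀ x ∈ A, (r x : X) = x := fun x hx => by simp [r, hx]
  have hmap : (U.map r).map ((↑) : A → X) = U := by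
    refine Ultrafilter.coe_injective ?_
    rw [Ultrafilter.coe_map, Ultrafilter.coe_map, Filter.map_map]
    have : ((↑) ∘ r : X → X) =ᶠ[(U : Filter X)] id := Filter.mem_of_superset hA hr
    rw [Filter.map_congr this, Filter.map_id]
  refine ⟨A, r, fun B hB => ?_, hmap⟩
  have hB' : ((↑) '' B : Set X) ∈ U := by
    rw [← hmap]
    exact Filter.image_mem_map hB
  rw [← Cardinal.mk_image_eq (s := B) Subtype.val_injective]
  by_contra! hlt
  exact (hmin hB' hlt.le).not_gt hlt

theorem not_tensorCommute_of_tendsto_atTop {X : Type u} {Y : Type v} {ι : Type w} [LinearOrder ι]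
    [NoMaxOrder ι] {F : Filter X} {G : Filter Y} [F.NeBot] [G.NeBot] {f : X → ι} {g : Y → ι}
    (hf : Tendsto f F atTop) (hg : Tendsto g G atTop) : ¬ TensorCommute F G := by
  intro h
  have h1 : ∀ᶠ x in F, ∀ᶠ y in G, f x < g y :=
    Eventually.of_forall fun x => hg.eventually_gt_atTop (f x)
  obtain ⟨y, hy⟩ := ((h _).1 h1).exists
  obtain ⟨x, hx, hx'⟩ := (hy.and (hf.eventually_ge_atTop (g y))).exists
  exact hx.not_ge hx'

theorem not_tensorCommute_of_regular {X : Type u} {Y : Type v} {F : Filter X} {W : Ultrafilter Y}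
    [F.NeBot] (R : X → Y → Prop) (hR : ∀ y, ∀ᶠ x in F, R x y) (hR' : ∀ x, ¬ ∀ᶠ y in W, R x y) :
    ¬ TensorCommute F (W : Filter Y) := by
  intro h
  obtain ⟨x, hx⟩ := ((h R).2 (Eventually.of_forall hR)).exists
  exact hR' x hx

theorem mk_Iio_ord_toType_lt {c : Cardinal.{u}} (i : c.ord.ToType) : #(Iio i) < c := by
  simpa using Cardinal.mk_Iio_lt i (by simp)

theorem IsUniform.tendsto_atTop {X : Type u} {U : Ultrafilter X} (hU : IsUniform U)
    (e : X ≃ (#X).ord.ToType) : Tendsto e U atTop := by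
  refine Filter.tendsto_atTop.2 fun i => ?_
  by_contra h
  have h' : ∀ᶠ x in U, e x < i := by
    simpa only [not_le] using Ultrafilter.eventually_not.2 h
  have h2 : #{x | e x < i} ≤ #(Iio i) :=
    Cardinal.mk_le_of_injective (f := fun x : {x | e x < i} => (⟨e x, x.2⟩ : Iio i))
      fun a b hab => by simpa [Subtype.ext_iff] using hab
  exact ((hU _ h').trans h2).not_gt (mk_Iio_ord_toType_lt i)

theorem exists_equiv_ord_toType (X : Type u) : Nonempty (X ≃ (#X).ord.ToType) :=
  Cardinal.eq.1 (by simp)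

theorem not_tensorCommute_of_mk_eq {X Y : Type u} {U : Ultrafilter X} {W : Ultrafilter Y}
    (hU : IsUniform U) (hW : IsUniform W) (hX : ℵ₀ ≤ #X) (hXY : #X = #Y) :
    ¬ TensorCommute (U : Filter X) (W : Filter Y) := by
  obtain ⟨e⟩ := exists_equiv_ord_toType X
  obtain ⟨e'⟩ := exists_equiv_ord_toType Y
  have h := hU.tendsto_atTop e
  have h' := hW.tendsto_atTop e'
  have := Cardinal.noMaxOrder hX
  generalize #X = c at *
  subst hXY
  exact not_tensorCommute_of_tendsto_atTop h h'

theorem not_tensorCommute_of_mk_eq_succ {X Y : Type u} {U : Ultrafilter X} {W : Ultrafilter Y}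
    (hU : IsUniform U) (hW : IsUniform W) (hY : ℵ₀ ≤ #Y) (hXY : #X = Order.succ #Y) :
    ¬ TensorCommute (U : Filter X) (W : Filter Y) := by
  have hlt : #Y < #X := hXY ▸ Order.lt_succ _
  have hX : ℵ₀ ≤ #X := hY.trans hlt.le
  obtain ⟨f⟩ := exists_equiv_ord_toType X
  obtain ⟨g⟩ := exists_equiv_ord_toType Y
  have hf := hU.tendsto_atTop f
  have hg := hW.tendsto_atTop g
  have := Cardinal.noMaxOrder hX
  have := Cardinal.noMaxOrder hY
  by_cases hb : ∃ h : X → (#Y).ord.ToType, Tendsto h U atTop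
  · obtain ⟨h, hh⟩ := hb
    exact not_tensorCommute_of_tendsto_atTop hh hg
  have hbound : ∀ h : X → (#Y).ord.ToType, ∃ j, ∀ᶠ x in U, h x < j := by
    intro h
    by_contra hcon
    rw [not_exists] at hcon
    refine hb ⟨h, tendsto_atTop.2 fun j => ?_⟩
    simpa only [not_lt] using Ultrafilter.eventually_not.2 (hcon j)
  have hinj : ∀ b : X, ∃ e : X → (#Y).ord.ToType, InjOn e {a | f a < f b} := by
    intro b
    have h1 : #{a | f a < f b} ≤ #(Iio (f b)) :=
      Cardinal.mk_le_of_injective (f := fun x : {a | f a < f b} => (⟨f x, x.2⟩ : Iio (f b)))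
        fun a b hab => by simpa [Subtype.ext_iff] using hab
    have h2 : #{a | f a < f b} ≤ #(#Y).ord.ToType := by
      rw [Cardinal.mk_ord_toType, ← Order.lt_succ_iff, ← hXY]
      exact h1.trans_lt (mk_Iio_ord_toType_lt _)
    obtain ⟨φ⟩ := h2
    have j₀ := g (W.nonempty_of_mem Filter.univ_mem).some
    classical
    refine ⟨fun a => if h : f a < f b then φ ⟨a, h⟩ else j₀, fun a ha a' ha' h => ?_⟩
    simp only [mem_ofPred_eq] at ha ha'
    simpa [ha, ha'] using h
  choose e he using hinj
  choose j hj using fun a => hbound fun b => e b a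
  obtain ⟨j₀, hj₀⟩ := Cardinal.infinite_pigeonhole_card_lt j (by simpa using hlt) hX
  rw [Cardinal.mk_ord_toType] at hj₀
  obtain ⟨t⟩ := hj₀.le
  refine not_tensorCommute_of_regular (fun x y => f (t y) < f x ∧ e x (t y) < j₀)
    (fun y => ?_) fun x hx => ?_
  · have := hj (t y)
    rw [show j (t y) = j₀ from (t y).2] at this
    exact (hf.eventually_gt_atTop _).and this
  · refine (hW _ hx).not_gt ?_
    refine lt_of_le_of_lt ?_ (mk_Iio_ord_toType_lt j₀)
    refine Cardinal.mk_le_of_injective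
      (f := fun y : {y | f (t y) < f x ∧ e x (t y) < j₀} => (⟨e x (t y), y.2.2⟩ : Iio j₀)) ?_
    intro a b hab
    have := he x a.2.1 b.2.1 (by simpa [Subtype.ext_iff] using hab)
    exact Subtype.ext (t.injective (Subtype.ext this))

theorem rectangleDetermined_of_isUniform
    (gch : ∀ kappa : Cardinal.{u}, ℵ₀ ≤ kappa → 2 ^ kappa = Order.succ kappa)
    (κ : Cardinal.{u}) : ∀ {X Y : Type u} {U : Ultrafilter X} {W : Ultrafilter Y},
    IsUniform U → IsUniform W → max #X #Y = κ → TensorCommute (U : Filter X) (W : Filter Y) →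
    RectangleDetermined (U : Filter X) (W : Filter Y) := by
  induction κ using WellFoundedLT.induction with
  | _ κ ih =>
  intro X Y U W hU hW hκ hc
  wlog hYX : #Y ≤ #X generalizing X Y
  · exact (this hW hU (max_comm #X #Y ▸ hκ) hc.symm (le_of_not_ge hYX)).symm hc.symm
  rw [max_eq_left hYX] at hκ
  rcases lt_or_ge #X ℵ₀ with hX | hX
  · have := Cardinal.lt_aleph0_iff_finite.1 hX
    exact rectangleDetermined_of_finite _ _
  rcases hYX.eq_or_lt with hYX | hYX
  · exact (not_tensorCommute_of_mk_eq hU hW hX hYX.symm hc).elim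
  rcases lt_or_ge #Y ℵ₀ with hY | hY
  · have := Cardinal.lt_aleph0_iff_finite.1 hY
    exact (rectangleDetermined_of_finite _ _).symm hc.symm
  intro R hR
  obtain ⟨A, r, hA, hmap⟩ := exists_isUniform_map (U.map R)
  have hAle : #A ≤ Order.succ #Y := by
    rw [← gch _ hY, ← Cardinal.mk_set]
    exact Cardinal.mk_set_le A
  rcases (hAle.trans (Order.succ_le_of_lt hYX)).eq_or_lt with h | h
  · exact (not_tensorCommute_of_mk_eq_succ hU hW hY
      ((h ▸ hAle).antisymm (Order.succ_le_of_lt hYX)) hc).elim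
  · have h1 := ih (max #A #Y) (hκ ▸ max_lt h hYX) hA hW rfl ((hc.map_left R).map_left r)
    have h2 := h1.map_left ((↑) : A → Y → Prop)
    rw [← Ultrafilter.coe_map, hmap] at h2
    have h3 := h2 (fun s y => s y) hR
    exact (tendsto_map.prodMap tendsto_id).eventually h3

theorem rectangleDetermined_of_tensorCommute
    (gch : ∀ kappa : Cardinal.{u}, ℵ₀ ≤ kappa → 2 ^ kappa = Order.succ kappa)
    {X Y : Type u} {U : Ultrafilter X} {W : Ultrafilter Y}
    (hc : TensorCommute (U : Filter X) (W : Filter Y)) :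
    RectangleDetermined (U : Filter X) (W : Filter Y) := by
  obtain ⟨A, r, hA, hU⟩ := exists_isUniform_map U
  obtain ⟨B, s, hB, hW⟩ := exists_isUniform_map W
  have hc1 : TensorCommute (U.map r : Filter A) (W.map s : Filter B) :=
    ((hc.map_left r).symm.map_left s).symm
  have h1 := (rectangleDetermined_of_isUniform gch _ hA hB rfl hc1).map_left ((↑) : A → X)
  rw [← Ultrafilter.coe_map, hU] at h1
  have hc2 : TensorCommute (U : Filter X) (W.map s : Filter B) := (hc.symm.map_left s).symm
  have h2 := (h1.symm hc2).map_left ((↑) : B → Y)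
  rw [← Ultrafilter.coe_map, hW] at h2
  exact h2.symm hc.symm

theorem tensor_comm_iff_prod_ultrafilter_of_gch {X Y : Type u}
    (gch : ∀ kappa : Cardinal.{u}, ℵ₀ ≤ kappa → 2 ^ kappa = Order.succ kappa)
    (U : Ultrafilter X) (W : Ultrafilter Y) :
    ltimes (U : Filter X) (W : Filter Y) = rtimes (U : Filter X) (W : Filter Y) ↔
      IsUltra ((U : Filter X) ×ˢ (W : Filter Y)) := by
  constructor
  · intro h
    have hd := rectangleDetermined_of_tensorCommute gch (ltimes_eq_rtimes_iff.1 h)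
    have : (U : Filter X) ×ˢ (W : Filter Y) = ltimes (U : Filter X) (W : Filter Y) :=
      le_antisymm (fun R hR => hd (fun x y => (x, y) ∈ R) hR) (ltimes_le_prod _ _)
    exact this ▸ isUltra_ltimes U W
  · rintro ⟨V, hV⟩
    have := ltimes_neBot (U : Filter X) (W : Filter Y)
    have := rtimes_neBot (U : Filter X) (W : Filter Y)
    exact (V.unique (hV.symm ▸ ltimes_le_prod _ _)).trans
      (V.unique (hV.symm ▸ rtimes_le_prod _ _)).symm
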